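/- There exists a constant c > 0 such that for every pair of distinct reals a, b and every n ≥ 1, the number of distinct values of per(A) over all n×n matrices A with every entry in {a,b} is at least exp(c·n). In particular, the number of distinct permanents of n×n ±1 matrices grows exponentially in n. -/

import Mathlib

open Finset

/-- The permanent of a square matrix. -/
noncomputable def perm {k : ℕ} (A : Matrix (Fin k) (Fin k) ℝ) : ℝ :=
  ∑ σ : Equiv.Perm (Fin k), ∏ i, A i (σ i)

section ListPermanent

variable {ι κ : Type*} [DecidableEq κ]

/-- The permanent of the rectangular array with the listed rows (repetitions allowed) and the
given set of columns: the sum over injections of the rows into the columns. -/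
noncomputable def listPerm (A : ι → κ → ℝ) : List ι → Finset κ → ℝ
  | [], _ => 1
  | r :: l, C => ∑ c ∈ C, A r c * listPerm A l (C.erase c)

variable (A : ι → κ → ℝ)

lemma listPerm_nil (C : Finset κ) : listPerm A [] C = 1 := rfl

lemma listPerm_cons (r : ι) (l : List ι) (C : Finset κ) :
    listPerm A (r :: l) C = ∑ c ∈ C, A r c * listPerm A l (C.erase c) := rfl

lemma sum_erase_swap (C : Finset κ) (f : κ → κ → ℝ) :
    ∑ c ∈ C, ∑ e ∈ C.erase c, f c e = ∑ e ∈ C, ∑ c ∈ C.erase e, f c e := by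
  refine Finset.sum_comm' fun x y => ?_
  simp only [mem_erase]
  tauto

lemma listPerm_perm {l l' : List ι} (h : l.Perm l') (C : Finset κ) :
    listPerm A l C = listPerm A l' C := by
  induction h generalizing C with
  | nil => rfl
  | cons r _ ih => simp only [listPerm_cons, ih]
  | swap r s l =>
    simp only [listPerm_cons, Finset.mul_sum]
    rw [sum_erase_swap]
    refine Finset.sum_congr rfl fun e _ => Finset.sum_congr rfl fun c _ => ?_
    rw [Finset.erase_right_comm]
    ring
  | trans _ _ ih₁ ih₂ => rw [ih₁, ih₂]

lemma listPerm_cons_insert (r : ι) (l : List ι) {p : κ} {Z : Finset κ} (hp : p ∉ Z) :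
    listPerm A (r :: l) (insert p Z) =
      A r p * listPerm A l Z + ∑ c ∈ Z, A r c * listPerm A l (insert p (Z.erase c)) := by
  rw [listPerm_cons, Finset.sum_insert hp, Finset.erase_insert hp]
  congr 1
  refine Finset.sum_congr rfl fun c hc => ?_
  rw [Finset.erase_insert_of_ne]
  rintro rfl
  exact hp hc

lemma listPerm_insert_congr {l : List ι} {p q : κ} (h : ∀ r ∈ l, A r p = A r q) {Z : Finset κ}
    (hp : p ∉ Z) (hq : q ∉ Z) : listPerm A l (insert p Z) = listPerm A l (insert q Z) := by
  induction l generalizing Z with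
  | nil => rfl
  | cons r l ih =>
    rw [listPerm_cons_insert A r l hp, listPerm_cons_insert A r l hq, h r (by simp)]
    congr 1
    refine Finset.sum_congr rfl fun c _ => ?_
    rw [ih (fun s hs => h s (by simp [hs])) (by simp [hp]) (by simp [hq])]

lemma listPerm_insert_sub {l : List ι} {p q : κ} (h : ∀ r ∈ l, A r p = A r q) {Z : Finset κ}
    (hp : p ∉ Z) (hq : q ∉ Z) (r s : ι) :
    listPerm A (r :: s :: l) (insert q Z) - listPerm A (r :: s :: l) (insert p Z) =
      (A r q - A r p) * listPerm A (s :: l) Z + (A s q - A s p) * listPerm A (r :: l) Z := by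
  have key : ∀ x, x ∉ Z → listPerm A (r :: s :: l) (insert x Z) =
      A r x * listPerm A (s :: l) Z + (A s x * listPerm A (r :: l) Z +
        ∑ c ∈ Z, A r c *
          ∑ e ∈ Z.erase c, A s e * listPerm A l (insert x ((Z.erase c).erase e))) := by
    intro x hx
    rw [listPerm_cons_insert A r _ hx, listPerm_cons A r l, Finset.mul_sum,
      ← Finset.sum_add_distrib]
    congr 1
    refine Finset.sum_congr rfl fun c _ => ?_
    rw [listPerm_cons_insert A s _ (by simp [hx])]
    ring
  rw [key p hp, key q hq]
  have : ∀ c e, listPerm A l (insert q ((Z.erase c).erase e)) =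
      listPerm A l (insert p ((Z.erase c).erase e)) := fun c e =>
    (listPerm_insert_congr A h (by simp [hp]) (by simp [hq])).symm
  simp only [this]
  ring

lemma listPerm_cons_sub (r s : ι) (l : List ι) (C : Finset κ) :
    listPerm A (r :: l) C - listPerm A (s :: l) C =
      ∑ c ∈ C, (A r c - A s c) * listPerm A l (C.erase c) := by
  rw [listPerm_cons, listPerm_cons, ← Finset.sum_sub_distrib]
  exact Finset.sum_congr rfl fun c _ => by ring

lemma listPerm_map_image {τ : ι → ι} {σ : κ → κ} (hσ : Function.Injective σ) {l : List ι}
    {C : Finset κ} (h : ∀ r ∈ l, ∀ c ∈ C, A (τ r) (σ c) = A r c) :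
    listPerm A (l.map τ) (C.image σ) = listPerm A l C := by
  induction l generalizing C with
  | nil => rfl
  | cons r l ih =>
    rw [List.map_cons, listPerm_cons, listPerm_cons, Finset.sum_image hσ.injOn]
    refine Finset.sum_congr rfl fun c hc => ?_
    rw [h r (by simp) c hc, ← Finset.image_erase hσ,
      ih fun s hs e he => h s (by simp [hs]) e (Finset.mem_of_mem_erase he)]

lemma listPerm_replicate {r : ι} (hr : ∀ c, A r c = 1) (K : ℕ) {C : Finset κ} (hC : C.card = K) :
    listPerm A (List.replicate K r) C = K.factorial := by
  induction K generalizing C with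
  | zero => simp [listPerm_nil]
  | succ K ih =>
    rw [List.replicate_succ, listPerm_cons]
    have : ∀ c ∈ C, A r c * listPerm A (List.replicate K r) (C.erase c) = K.factorial := by
      intro c hc
      rw [hr, one_mul, ih (by rw [Finset.card_erase_of_mem hc, hC]; rfl)]
    rw [Finset.sum_congr rfl this, Finset.sum_const, hC, nsmul_eq_mul, Nat.factorial_succ]
    push_cast
    ring

/-- If all rows are close to the constant row `1`, and most are equal to it, then the permanent is
close to a factorial. -/
lemma abs_listPerm_sub_factorial_le {r₀ : ι} (hr₀ : ∀ c, A r₀ c = 1) {K : ℕ} (hK : 0 < K)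
    (l : List ι) {C : Finset κ} (hl : ∀ r ∈ l, ∑ c ∈ C, |A r c - 1| ≤ 4)
    (hC : C.card = l.length + K) (hlK : 8 * l.length ≤ K) :
    |listPerm A (l ++ List.replicate K r₀) C - (C.card.factorial : ℝ)| ≤
      8 * l.length / K * C.card.factorial := by
  induction l generalizing C with
  | nil =>
    simp only [List.length_nil, zero_add] at hC
    simp [listPerm_replicate A hr₀ K hC, hC]
  | cons r l ih =>
    simp only [List.length_cons] at hC hlK
    have hK' : (0 : ℝ) < K := by exact_mod_cast hK
    set k := l.length + K with hk
    have hC' : C.card = k + 1 := by omega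
    have hF : (0 : ℝ) < (k.factorial : ℝ) := by exact_mod_cast Nat.factorial_pos k
    set P : κ → ℝ := fun c => listPerm A (l ++ List.replicate K r₀) (C.erase c) with hP
    set ε : ℝ := 8 * l.length / K with hε
    have hε1 : ε ≤ 1 := by
      rw [hε, div_le_one hK']
      exact_mod_cast (by omega : 8 * l.length ≤ K)
    have hPc : ∀ c ∈ C, |P c - k.factorial| ≤ ε * k.factorial := by
      intro c hc
      have hcard : (C.erase c).card = k := by rw [Finset.card_erase_of_mem hc, hC']; rfl
      have := ih (C := C.erase c)
        (fun s hs => (Finset.sum_le_sum_of_subset_of_nonneg (Finset.erase_subset c C)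
          fun _ _ _ => abs_nonneg _).trans (hl s (by simp [hs]))) hcard (by omega)
      rwa [hcard] at this
    have hPc' : ∀ c ∈ C, |P c| ≤ 2 * k.factorial := by
      intro c hc
      have h1 := abs_le.1 (hPc c hc)
      rw [abs_le]
      constructor <;> nlinarith
    have hsplit : listPerm A (r :: l ++ List.replicate K r₀) C - (C.card.factorial : ℝ) =
        ∑ c ∈ C, (A r c - 1) * P c + ∑ c ∈ C, (P c - k.factorial) := by
      rw [List.cons_append, listPerm_cons, Finset.sum_sub_distrib, Finset.sum_const, hC',
        Nat.factorial_succ, nsmul_eq_mul, ← add_sub_assoc, ← Finset.sum_add_distrib]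
      push_cast
      congr 1
      exact Finset.sum_congr rfl fun c _ => by rw [hP]; ring
    have h1 : |∑ c ∈ C, (A r c - 1) * P c| ≤ 8 * k.factorial := by
      calc |∑ c ∈ C, (A r c - 1) * P c| ≤ ∑ c ∈ C, |A r c - 1| * (2 * k.factorial) := by
            refine (Finset.abs_sum_le_sum_abs _ _).trans (Finset.sum_le_sum fun c hc => ?_)
            rw [abs_mul]
            exact mul_le_mul_of_nonneg_left (hPc' c hc) (abs_nonneg _)
        _ = (∑ c ∈ C, |A r c - 1|) * (2 * k.factorial) := by rw [Finset.sum_mul]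
        _ ≤ 4 * (2 * k.factorial) :=
            mul_le_mul_of_nonneg_right (hl r (by simp)) (by positivity)
        _ = 8 * k.factorial := by ring
    have h2 : |∑ c ∈ C, (P c - k.factorial)| ≤ (k + 1) * (ε * k.factorial) := by
      refine (Finset.abs_sum_le_sum_abs _ _).trans ((Finset.sum_le_sum hPc).trans ?_)
      rw [Finset.sum_const, hC', nsmul_eq_mul]
      push_cast
      exact le_rfl
    rw [hsplit, hC', Nat.factorial_succ]
    have h3 : (8 : ℝ) * k.factorial ≤ 8 / K * ((k + 1) * k.factorial) := by
      have : (K : ℝ) ≤ k + 1 := by exact_mod_cast (by omega : K ≤ k + 1)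
      rw [div_mul_eq_mul_div, le_div_iff₀ hK']
      nlinarith
    refine (abs_add_le _ _).trans ((add_le_add h1 h2).trans ((add_le_add_left h3 _).trans
      (le_of_eq ?_)))
    rw [hε]
    push_cast [List.length_cons]
    ring

lemma perm_succ {n : ℕ} (M : Matrix (Fin (n + 1)) (Fin (n + 1)) ℝ) :
    perm M = ∑ p, M 0 p * perm (Matrix.of fun i j : Fin n => M i.succ (Equiv.swap 0 p j.succ)) := by
  unfold perm
  rw [← Equiv.sum_comp (Equiv.Perm.decomposeFin (n := n)).symm, Fintype.sum_prod_type]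
  refine Finset.sum_congr rfl fun p _ => ?_
  rw [Finset.mul_sum]
  refine Finset.sum_congr rfl fun e _ => ?_
  rw [Fin.prod_univ_succ, Equiv.Perm.decomposeFin_symm_apply_zero]
  simp only [Equiv.Perm.decomposeFin_symm_apply_succ, Matrix.of_apply]

lemma perm_eq_listPerm (l : List ι) {n : ℕ} (hn : l.length = n) {f : Fin n → κ}
    (hf : Function.Injective f) :
    perm (Matrix.of fun i j => A (l.get (i.cast hn.symm)) (f j)) = listPerm A l (univ.image f) := by
  induction l generalizing n with
  | nil =>
    subst hn
    simp [perm, listPerm_nil]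
  | cons r l ih =>
    obtain rfl : n = l.length + 1 := hn.symm
    rw [perm_succ, listPerm_cons, Finset.sum_image hf.injOn]
    refine Finset.sum_congr rfl fun p _ => ?_
    have hg : Function.Injective fun j : Fin l.length => f (Equiv.swap 0 p j.succ) :=
      hf.comp ((Equiv.injective _).comp (Fin.succ_injective _))
    have himg : (univ.image f).erase (f p) =
        univ.image fun j : Fin l.length => f (Equiv.swap 0 p j.succ) := by
      ext c
      simp only [mem_erase, mem_image, mem_univ, true_and]
      constructor
      · rintro ⟨hne, x, rfl⟩
        have hx : Equiv.swap 0 p x ≠ 0 := by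
          intro h
          rw [Equiv.swap_apply_eq_iff, Equiv.swap_apply_left] at h
          exact hne (by rw [h])
        obtain ⟨y, hy⟩ := Fin.exists_succ_eq.2 hx
        exact ⟨y, by rw [hy, Equiv.swap_apply_self]⟩
      · rintro ⟨y, rfl⟩
        refine ⟨fun h => ?_, _, rfl⟩
        have := hf h
        rw [Equiv.swap_apply_eq_iff, Equiv.swap_apply_right] at this
        exact Fin.succ_ne_zero _ this
    rw [himg, ← ih rfl hg]
    rfl

end ListPermanent

section TwinPaths

/-- Columns of the construction: two lanes of columns, columns carrying a set of
naturals (the bits to be encoded), and padding columns. -/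
inductive Col
  | lane (b : Bool) (j : ℕ)
  | code (S : Finset ℕ)
  | pad (j : ℕ)

noncomputable instance : DecidableEq Col := Classical.decEq Col

open Col

/-- The entries of the construction. Row `some (b, i)` is row `i` of lane `b`; `none` is
the constant row. -/
noncomputable def entry (d : ℝ) : Option (Bool × ℕ) → Col → ℝ
  | some (b, i), lane b' j => if b = b' ∧ (j = i ∨ j = i + 1) then 1 + d else 1
  | some (b, i), code S => if b = decide (i ∈ S) then 1 + d else 1
  | _, _ => 1

/-- The `2 * t` rows of both lanes with index in `[j, j + t)`. -/
def twinRows : ℕ → ℕ → List (Option (Bool × ℕ))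
  | 0, _ => []
  | t + 1, j => some (true, j) :: some (false, j) :: twinRows t (j + 1)

/-- Lane columns with index from `j` to `m`, without the last one of lane `false`. -/
noncomputable def laneCols (j m : ℕ) : Finset Col :=
  (Icc j m).image (lane true) ∪ (Ico j m).image (lane false)

/-- Both lanes up to index `i`, together with padding columns. -/
noncomputable def baseCols (κ i : ℕ) : Finset Col :=
  ((range i).image (lane true) ∪ (range i).image (lane false)) ∪ (range κ).image pad

lemma entry_none (d : ℝ) (c : Col) : entry d none c = 1 := by cases c <;> rfl

lemma entry_eq_one_or (d : ℝ) (r : Option (Bool × ℕ)) (c : Col) :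
    entry d r c = 1 ∨ entry d r c = 1 + d := by
  rcases r with _ | ⟨b, i⟩ <;> rcases c with ⟨b', j⟩ | S | j <;> 
    first
    | exact Or.inl rfl
    | exact (ite_eq_or_eq _ _ _).symm

lemma mem_twinRows {t j : ℕ} {r : Option (Bool × ℕ)} (h : r ∈ twinRows t j) :
    ∃ b i, r = some (b, i) ∧ j ≤ i ∧ i < j + t := by
  induction t generalizing j with
  | zero => simp [twinRows] at h
  | succ t ih =>
    simp only [twinRows, List.mem_cons] at h
    rcases h with rfl | rfl | h
    · exact ⟨_, _, rfl, le_rfl, by omega⟩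
    · exact ⟨_, _, rfl, le_rfl, by omega⟩
    · obtain ⟨b, i, rfl, h1, h2⟩ := ih h
      exact ⟨_, _, rfl, by omega, by omega⟩

lemma length_twinRows (t j : ℕ) : (twinRows t j).length = 2 * t := by
  induction t generalizing j with
  | zero => rfl
  | succ t ih => simp only [twinRows, List.length_cons, ih]; ring

lemma twinRows_add (s t j : ℕ) : twinRows (s + t) j = twinRows s j ++ twinRows t (j + s) := by
  induction s generalizing j with
  | zero => simp [twinRows]
  | succ s ih =>
    rw [Nat.add_right_comm]
    simp only [twinRows, List.cons_append, ih]
    rw [add_right_comm j 1 s, add_assoc j s 1]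

lemma mem_laneCols {j m : ℕ} {c : Col} : c ∈ laneCols j m ↔
    ∃ b k, c = lane b k ∧ j ≤ k ∧ k ≤ m ∧ (b = true ∨ k < m) := by
  simp only [laneCols, mem_union, mem_image, mem_Icc, mem_Ico]
  constructor
  · rintro (⟨k, hk, rfl⟩ | ⟨k, hk, rfl⟩)
    · exact ⟨_, _, rfl, hk.1, hk.2, Or.inl rfl⟩
    · exact ⟨_, _, rfl, hk.1, hk.2.le, Or.inr hk.2⟩
  · rintro ⟨_ | _, k, rfl, h1, h2, h3⟩
    · exact Or.inr ⟨k, ⟨h1, h3.resolve_left (by simp)⟩, rfl⟩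
    · exact Or.inl ⟨k, ⟨h1, h2⟩, rfl⟩

lemma lane_mem_laneCols {j m k : ℕ} {b : Bool} :
    lane b k ∈ laneCols j m ↔ j ≤ k ∧ k ≤ m ∧ (b = true ∨ k < m) := by
  simp [mem_laneCols]

lemma code_notMem_laneCols {j m : ℕ} {S : Finset ℕ} : code S ∉ laneCols j m := by
  simp [mem_laneCols]

lemma pad_notMem_laneCols {j m k : ℕ} : pad k ∉ laneCols j m := by
  simp [mem_laneCols]

lemma lane_mem_baseCols {κ i k : ℕ} {b : Bool} : lane b k ∈ baseCols κ i ↔ k < i := by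
  cases b <;> simp [baseCols]

lemma code_notMem_baseCols {κ i : ℕ} {S : Finset ℕ} : code S ∉ baseCols κ i := by
  simp [baseCols]

lemma pad_mem_baseCols {κ i k : ℕ} : pad k ∈ baseCols κ i ↔ k < κ := by
  simp [baseCols]

lemma card_baseCols (κ i : ℕ) : (baseCols κ i).card = 2 * i + κ := by
  have h1 : Function.Injective (lane true) := fun x y h => by simpa using h
  have h2 : Function.Injective (lane false) := fun x y h => by simpa using h
  have h3 : Function.Injective pad := fun x y h => by simpa using h
  rw [baseCols, card_union_of_disjoint, card_union_of_disjoint, card_image_of_injective _ h1,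
    card_image_of_injective _ h2, card_image_of_injective _ h3]
  · simp; ring
  · simp [Finset.disjoint_left]
  · simp only [Finset.disjoint_left, mem_union, mem_image]
    rintro c (⟨_, _, rfl⟩ | ⟨_, _, rfl⟩) ⟨_, _, h⟩ <;> simp at h

lemma laneCols_union_baseCols (κ : ℕ) {i j m : ℕ} (hij : i ≤ j) (hj : j ≤ m) :
    laneCols i m ∪ baseCols κ i = laneCols j m ∪ baseCols κ j := by
  ext c
  rcases c with ⟨b, k⟩ | S | k
  · simp only [mem_union, lane_mem_laneCols, lane_mem_baseCols]
    cases b <;> simp <;> omega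
  · simp [code_notMem_baseCols, code_notMem_laneCols]
  · simp [pad_notMem_laneCols, pad_mem_baseCols]

variable (d : ℝ)

/-- The difference of the minors obtained by deleting the two lane columns of index `j`. -/
noncomputable def twinDiff (l : List (Option (Bool × ℕ))) (Z : Finset Col) (j : ℕ) : ℝ :=
  (if lane true j ∈ Z then listPerm (entry d) l (Z.erase (lane true j)) else 0) -
    (if lane false j ∈ Z then listPerm (entry d) l (Z.erase (lane false j)) else 0)

lemma listPerm_twin_sub (l : List (Option (Bool × ℕ))) {Z : Finset Col} (hZ : ∀ S, code S ∉ Z)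
    (j : ℕ) :
    listPerm (entry d) (some (true, j) :: l) Z - listPerm (entry d) (some (false, j) :: l) Z =
      d * (twinDiff d l Z j + twinDiff d l Z (j + 1)) := by
  rw [listPerm_cons_sub]
  have key : ∀ c ∈ Z, (entry d (some (true, j)) c - entry d (some (false, j)) c) *
      listPerm (entry d) l (Z.erase c) =
      d * (((if c = lane true j then listPerm (entry d) l (Z.erase c) else 0) -
        (if c = lane false j then listPerm (entry d) l (Z.erase c) else 0)) +
        ((if c = lane true (j + 1) then listPerm (entry d) l (Z.erase c) else 0) -
        (if c = lane false (j + 1) then listPerm (entry d) l (Z.erase c) else 0))) := by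
    intro c hc
    rcases c with ⟨b, k⟩ | S | k
    · by_cases h1 : k = j
      · cases b <;> simp [entry, h1]
      · by_cases h2 : k = j + 1 <;> cases b <;> simp [entry, h1, h2]
    · exact absurd hc (hZ S)
    · simp [entry]
  rw [Finset.sum_congr rfl key, ← Finset.mul_sum, Finset.sum_add_distrib, Finset.sum_sub_distrib,
    Finset.sum_sub_distrib]
  simp only [Finset.sum_ite_eq', twinDiff]

lemma entry_lane_of_lt {b b' : Bool} {i k : ℕ} (h : k < i) :
    entry d (some (b, i)) (lane b' k) = 1 := by
  simp only [entry]
  rw [if_neg (by omega)]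

lemma entry_lane_of_gt {b b' : Bool} {i k : ℕ} (h : i + 1 < k) :
    entry d (some (b, i)) (lane b' k) = 1 := by
  simp only [entry]
  rw [if_neg (by omega)]

lemma twinDiff_laneCols_union {l : List (Option (Bool × ℕ))} {Z : Finset Col} (t j : ℕ)
    (hl : ∀ r ∈ l, ∀ b k, j ≤ k → entry d r (lane b k) = 1)
    (hZ : ∀ b k, j ≤ k → lane b k ∉ Z) (hZ' : ∀ S, code S ∉ Z) :
    twinDiff d (twinRows t j ++ l) (laneCols j (j + t) ∪ Z) j =
      d ^ (2 * t) * listPerm (entry d) l Z := by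
  induction t generalizing j with
  | zero =>
    have h0 : laneCols j (j + 0) = {lane true j} := by simp [laneCols]
    rw [h0, twinDiff, if_pos (by simp), if_neg (by simp [hZ false j le_rfl])]
    rw [Finset.singleton_union, Finset.erase_insert (hZ _ _ le_rfl)]
    simp [twinRows]
  | succ t ih =>
    set Y := laneCols (j + 1) (j + 1 + t) ∪ Z with hY
    have hYj : ∀ b, lane b j ∉ Y := by
      intro b
      simp [hY, lane_mem_laneCols, hZ b j le_rfl]
    have hYc : ∀ S, code S ∉ Y := by
      intro S
      simp [hY, code_notMem_laneCols, hZ' S]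
    have hcols : laneCols j (j + (t + 1)) ∪ Z = insert (lane true j) (insert (lane false j) Y) := by
      ext c
      rcases c with ⟨b, k⟩ | S | k
      · by_cases h : lane b k ∈ Z
        · simp [hY, h]
        · cases b <;> simp [hY, h, lane_mem_laneCols] <;> omega
      · simp [hY, code_notMem_laneCols]
      · simp [hY, pad_notMem_laneCols]
    have hdiff := ih (j + 1) (fun r hr b k hk => hl r hr b k (by omega))
      (fun b k hk => hZ b k (by omega))
    have hzero : twinDiff d (twinRows t (j + 1) ++ l) Y j = 0 := by
      simp [twinDiff, hYj]
    have hblind : ∀ r ∈ twinRows t (j + 1) ++ l,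
        entry d r (lane true j) = entry d r (lane false j) := by
      intro r hr
      rcases List.mem_append.1 hr with hr | hr
      · obtain ⟨b, i, rfl, hi, -⟩ := mem_twinRows hr
        rw [entry_lane_of_lt d (by omega), entry_lane_of_lt d (by omega)]
      · rw [hl r hr _ _ le_rfl, hl r hr _ _ le_rfl]
    have e1 : (insert (lane true j) (insert (lane false j) Y)).erase (lane true j) =
        insert (lane false j) Y := Finset.erase_insert (by simp [hYj])
    have e2 : (insert (lane true j) (insert (lane false j) Y)).erase (lane false j) =
        insert (lane true j) Y := by
      rw [Finset.insert_comm, Finset.erase_insert (by simp [hYj])]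
    rw [hcols, twinDiff, if_pos (by simp), if_pos (by simp), e1, e2]
    simp only [twinRows, List.cons_append]
    rw [listPerm_insert_sub _ hblind (hYj _) (hYj _)]
    have hsub := listPerm_twin_sub d (twinRows t (j + 1) ++ l) hYc j
    rw [hzero, hdiff] at hsub
    have v1 : entry d (some (true, j)) (lane false j) - entry d (some (true, j)) (lane true j) =
      -d := by simp [entry]
    have v2 : entry d (some (false, j)) (lane false j) - entry d (some (false, j)) (lane true j) =
      d := by simp [entry]
    rw [v1, v2]
    linear_combination d * hsub

/-- Exchange the lanes of the columns with index less than `i`. -/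
def flipCol (i : ℕ) : Col → Col
  | lane b k => lane (if k < i then !b else b) k
  | c => c

/-- Exchange the lanes of the rows with index less than `i`. -/
def flipRow (i : ℕ) : Option (Bool × ℕ) → Option (Bool × ℕ)
  | some (b, k) => some (if k < i then !b else b, k)
  | none => none

lemma flipCol_flipCol (i : ℕ) (c : Col) : flipCol i (flipCol i c) = c := by
  rcases c with ⟨b, k⟩ | S | k <;> simp only [flipCol]
  split_ifs <;> simp

lemma map_flipRow_twinRows (i t j : ℕ) :
    ((twinRows t j).map (flipRow i)).Perm (twinRows t j) := by
  induction t generalizing j with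
  | zero => exact List.Perm.refl _
  | succ t ih =>
    simp only [twinRows, List.map_cons, flipRow]
    split_ifs
    · exact (List.Perm.swap _ _ _).trans (((ih _).cons _).cons _)
    · exact ((ih _).cons _).cons _

lemma twinDiff_prefix_eq_zero (κ K i t : ℕ) :
    twinDiff d (twinRows i 0 ++ (twinRows t (i + 1) ++ List.replicate K none))
      (laneCols 0 (i + 1 + t) ∪ baseCols κ 0) i = 0 := by
  set Z := laneCols 0 (i + 1 + t) ∪ baseCols κ 0 with hZ
  have hlane : ∀ b k, lane b k ∈ Z ↔ k ≤ i + 1 + t ∧ (b = true ∨ k < i + 1 + t) := by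
    simp [hZ, lane_mem_laneCols, lane_mem_baseCols]
  have hcode : ∀ S, code S ∉ Z := by simp [hZ, code_notMem_baseCols, code_notMem_laneCols]
  have hinj : Function.Injective (flipCol (i + 1)) :=
    Function.Involutive.injective (flipCol_flipCol (i + 1))
  have hfix : ∀ c, c ∈ Z → flipCol (i + 1) c ∈ Z := by
    intro c hc
    rcases c with ⟨b, k⟩ | S | k <;> simp only [flipCol]
    · rw [hlane] at hc ⊢
      split_ifs
      · exact ⟨hc.1, Or.inr (by omega)⟩
      · exact hc
    · exact hc
    · exact hc
  have himg : Z.image (flipCol (i + 1)) = Z := by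
    ext c
    rw [mem_image]
    exact ⟨fun ⟨e, he, h⟩ => h ▸ hfix e he, fun hc => ⟨_, hfix c hc, flipCol_flipCol _ c⟩⟩
  have herase : Z.erase (lane false i) = (Z.erase (lane true i)).image (flipCol (i + 1)) := by
    rw [Finset.image_erase hinj, himg]
    simp [flipCol]
  set l := twinRows i 0 ++ (twinRows t (i + 1) ++ List.replicate K none) with hl
  have hperm : (l.map (flipRow i)).Perm l := by
    rw [hl, List.map_append, List.map_append, List.map_replicate]
    exact (map_flipRow_twinRows _ _ _).append
      ((map_flipRow_twinRows _ _ _).append (List.Perm.refl _))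
  have hinv : ∀ r ∈ l, ∀ c ∈ Z.erase (lane true i),
      entry d (flipRow i r) (flipCol (i + 1) c) = entry d r c := by
    intro r hr c hc
    rcases c with ⟨b', k⟩ | S | k
    · have hr' : r = none ∨ ∃ b q, r = some (b, q) ∧ q ≠ i := by
        simp only [hl, List.mem_append] at hr
        rcases hr with hr | hr | hr
        · obtain ⟨b, q, rfl, -, h⟩ := mem_twinRows hr
          exact Or.inr ⟨b, q, rfl, by omega⟩
        · obtain ⟨b, q, rfl, h, -⟩ := mem_twinRows hr
          exact Or.inr ⟨b, q, rfl, by omega⟩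
        · exact Or.inl (List.eq_of_mem_replicate hr)
      rcases hr' with rfl | ⟨b, q, rfl, hq⟩
      · rw [flipRow, entry_none, entry_none]
      · simp only [flipRow, flipCol]
        by_cases hki : k < q ∨ q + 1 < k
        · rcases hki with hk | hk
          · rw [entry_lane_of_lt d hk, entry_lane_of_lt d hk]
          · rw [entry_lane_of_gt d hk, entry_lane_of_gt d hk]
        · by_cases hqi : q < i
          · rw [if_pos hqi, if_pos (by omega)]
            simp [entry]
          · rw [if_neg hqi, if_neg (by omega)]
    · exact absurd (Finset.mem_of_mem_erase hc) (hcode S)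
    · rcases r with _ | ⟨b, q⟩ <;> rfl
  rw [twinDiff, if_pos ((hlane _ _).2 ⟨by omega, Or.inl rfl⟩),
    if_pos ((hlane _ _).2 ⟨by omega, Or.inr (by omega)⟩), herase,
    ← listPerm_perm _ hperm, listPerm_perm _ hperm, ← listPerm_perm _ hperm (image _ _),
    listPerm_map_image _ hinj hinv, sub_self]

/-- The permanent encoding the set `S`. -/
noncomputable def codePerm (m K κ : ℕ) (S : Finset ℕ) : ℝ :=
  listPerm (entry d) (twinRows m 0 ++ List.replicate K none)
    (insert (code S) (laneCols 0 m ∪ baseCols κ 0))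

/-- The minor governing the weight of bit `i`. -/
noncomputable def bitMinor (K κ i : ℕ) : ℝ :=
  listPerm (entry d) (twinRows i 0 ++ List.replicate K none) (baseCols κ (i + 1))

lemma codePerm_insert (m K κ : ℕ) {i : ℕ} (hi : i < m) {S : Finset ℕ} (hiS : i ∉ S) :
    codePerm d m K κ (insert i S) =
      codePerm d m K κ S - d ^ (2 * (m - i)) * bitMinor d K κ i := by
  obtain ⟨t, rfl⟩ : ∃ t, m = i + 1 + t := ⟨m - (i + 1), by omega⟩
  set l := twinRows i 0 ++ (twinRows t (i + 1) ++ List.replicate K none) with hl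
  set Z := laneCols 0 (i + 1 + t) ∪ baseCols κ 0 with hZ
  have hcode : ∀ S, code S ∉ Z := by simp [hZ, code_notMem_baseCols, code_notMem_laneCols]
  have hrows : (twinRows (i + 1 + t) 0 ++ List.replicate K none).Perm
      (some (true, i) :: some (false, i) :: l) := by
    rw [add_assoc, add_comm 1 t, twinRows_add, List.append_assoc, zero_add, hl]
    simp only [twinRows, List.cons_append]
    exact List.perm_middle.trans (List.perm_middle.cons _)
  have hblind : ∀ r ∈ l, entry d r (code S) = entry d r (code (insert i S)) := by
    have : ∀ b q, q ≠ i → entry d (some (b, q)) (code S) =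
        entry d (some (b, q)) (code (insert i S)) := by
      intro b q hq
      simp [entry, hq]
    intro r hr
    simp only [hl, List.mem_append] at hr
    rcases hr with hr | hr | hr
    · obtain ⟨b, q, rfl, -, h⟩ := mem_twinRows hr
      exact this b q (by omega)
    · obtain ⟨b, q, rfl, h, -⟩ := mem_twinRows hr
      exact this b q (by omega)
    · rw [List.eq_of_mem_replicate hr, entry_none, entry_none]
  have hstep := listPerm_insert_sub (entry d) hblind (hcode S) (hcode (insert i S))
    (some (true, i)) (some (false, i))
  have v1 : entry d (some (true, i)) (code (insert i S)) - entry d (some (true, i)) (code S) =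
    d := by simp [entry, hiS]
  have v2 : entry d (some (false, i)) (code (insert i S)) - entry d (some (false, i)) (code S) =
    -d := by simp [entry, hiS]
  rw [v1, v2] at hstep
  have hsub := listPerm_twin_sub d l hcode i
  rw [twinDiff_prefix_eq_zero] at hsub
  have hperm : l.Perm (twinRows t (i + 1) ++ (twinRows i 0 ++ List.replicate K none)) := by
    rw [hl, ← List.append_assoc, ← List.append_assoc]
    exact List.perm_append_comm.append_right _
  have hfwd : twinDiff d l Z (i + 1) = d ^ (2 * t) * bitMinor d K κ i := by
    have := twinDiff_laneCols_union d (l := twinRows i 0 ++ List.replicate K none)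
      (Z := baseCols κ (i + 1)) t (i + 1) ?_ ?_ ?_
    · rw [bitMinor, ← this, hZ, laneCols_union_baseCols κ (Nat.zero_le (i + 1)) (by omega)]
      simp only [twinDiff, listPerm_perm (entry d) hperm]
    · intro r hr b k hk
      rcases List.mem_append.1 hr with hr | hr
      · obtain ⟨b', q, rfl, -, h⟩ := mem_twinRows hr
        exact entry_lane_of_gt d (by omega)
      · rw [List.eq_of_mem_replicate hr, entry_none]
    · intro b k hk
      rw [lane_mem_baseCols]
      omega
    · intro S
      exact code_notMem_baseCols
  rw [hfwd] at hsub
  rw [codePerm, codePerm, listPerm_perm _ hrows, listPerm_perm _ hrows]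
  have hpow : d ^ (2 * (i + 1 + t - i)) = d * d * d ^ (2 * t) := by
    rw [show 2 * (i + 1 + t - i) = 2 + 2 * t by omega, pow_add]
    ring
  rw [hpow]
  linear_combination hstep - d * hsub

lemma codePerm_eq_sum (m K κ : ℕ) {S : Finset ℕ} (hS : S ⊆ range m) :
    codePerm d m K κ S =
      codePerm d m K κ ∅ - ∑ i ∈ S, d ^ (2 * (m - i)) * bitMinor d K κ i := by
  induction S using Finset.induction_on with
  | empty => simp
  | insert i S hi ih =>
    rw [codePerm_insert d m K κ (by simpa using hS (mem_insert_self i S)) hi,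
      ih ((subset_insert _ _).trans hS), Finset.sum_insert hi]
    ring

end TwinPaths

section Counting

lemma sum_abs_entry_sub_one_le {d : ℝ} (hd : |d| ≤ 2) (r : Option (Bool × ℕ)) {C : Finset Col}
    (hC : ∀ S, Col.code S ∉ C) : ∑ c ∈ C, |entry d r c - 1| ≤ 4 := by
  rcases r with _ | ⟨b, i⟩
  · simp [entry_none]
  · calc ∑ c ∈ C, |entry d (some (b, i)) c - 1|
        ≤ ∑ c ∈ C, ((if c = Col.lane b i then 2 else 0) +
            (if c = Col.lane b (i + 1) then 2 else 0) : ℝ) := by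
          refine Finset.sum_le_sum fun c hc => ?_
          rcases c with ⟨b', k⟩ | S | k
          · by_cases hb : b = b'
            · subst hb
              by_cases h1 : k = i
              · simp [entry, h1, hd]
              · by_cases h2 : k = i + 1 <;> simp [entry, h1, h2, hd]
            · simp [entry, hb, Ne.symm hb]
          · exact absurd hc (hC S)
          · simp [entry]
      _ ≤ 4 := by
          rw [Finset.sum_add_distrib, Finset.sum_ite_eq', Finset.sum_ite_eq']
          split_ifs <;> norm_num

lemma abs_bitMinor_sub_factorial_le {d : ℝ} (hd : |d| ≤ 2) {κ i : ℕ} (h : 32 * i ≤ κ + 2) :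
    |bitMinor d (κ + 2) κ i - ((2 * i + (κ + 2)).factorial : ℝ)| ≤
      1 / 2 * (2 * i + (κ + 2)).factorial := by
  have hcard : (baseCols κ (i + 1)).card = 2 * i + (κ + 2) := by
    rw [card_baseCols]
    ring
  have key := abs_listPerm_sub_factorial_le (entry d) (entry_none d) (K := κ + 2) (by omega)
    (twinRows i 0) (C := baseCols κ (i + 1))
    (fun r _ => sum_abs_entry_sub_one_le hd r fun _ => code_notMem_baseCols)
    (by rw [hcard, length_twinRows]) (by rw [length_twinRows]; omega)
  rw [hcard, length_twinRows] at key
  refine key.trans (mul_le_mul_of_nonneg_right ?_ (by positivity))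
  rw [div_le_iff₀ (by positivity)]
  have : ((32 * i : ℕ) : ℝ) ≤ ((κ + 2 : ℕ) : ℝ) := by exact_mod_cast h
  push_cast at this ⊢
  linarith

/-- Subset sums of a sequence that at least doubles in absolute value are distinct. -/
lemma injOn_subset_sum {E : ℕ → ℝ} {m : ℕ} (h0 : ∀ i < m, E i ≠ 0)
    (h2 : ∀ i, i + 1 < m → 2 * |E i| ≤ |E (i + 1)|) :
    Set.InjOn (fun S : Finset ℕ => ∑ i ∈ S, E i) {S | S ⊆ range m} := by
  have hsum : ∀ k < m, ∑ i ∈ range k, |E i| < |E k| := by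
    intro k hk
    induction k with
    | zero => simpa using h0 0 hk
    | succ k ih =>
      rw [Finset.sum_range_succ]
      linarith [ih (by omega), h2 k hk]
  have hne : ∀ k < m, ∀ S T : Finset ℕ, S ⊆ range k → T ⊆ range k →
      ∑ i ∈ S, E i ≠ E k + ∑ i ∈ T, E i := by
    intro k hk S T hS hT h
    have hdiff : E k = ∑ i ∈ range k, ((if i ∈ S then E i else 0) - if i ∈ T then E i else 0) := by
      rw [Finset.sum_sub_distrib, Finset.sum_ite_mem, Finset.sum_ite_mem,
        Finset.inter_eq_right.2 hS, Finset.inter_eq_right.2 hT, h]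
      ring
    refine absurd (hsum k hk) (not_lt.2 ?_)
    rw [hdiff]
    refine (Finset.abs_sum_le_sum_abs _ _).trans (Finset.sum_le_sum fun i _ => ?_)
    split_ifs <;> simp
  clear h0 h2 hsum
  induction m with
  | zero =>
    intro S hS T hT _
    rw [Finset.subset_empty.1 hS, Finset.subset_empty.1 hT]
  | succ m ih =>
    have herase : ∀ S : Finset ℕ, S ⊆ range (m + 1) → S.erase m ⊆ range m := fun S hS => by
      rwa [← Finset.subset_insert_iff, ← Finset.range_add_one]
    intro S hS T hT hST
    simp only at hST
    have hrest := ih fun k hk => hne k (hk.trans (Nat.lt_succ_self m))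
    by_cases hmS : m ∈ S <;> by_cases hmT : m ∈ T
    · rw [← Finset.add_sum_erase S _ hmS, ← Finset.add_sum_erase T _ hmT] at hST
      rw [← Finset.insert_erase hmS, ← Finset.insert_erase hmT,
        hrest (herase S hS) (herase T hT) (add_left_cancel hST)]
    · rw [← Finset.add_sum_erase S _ hmS, ← Finset.erase_eq_of_notMem hmT] at hST
      exact absurd hST.symm (hne m (Nat.lt_succ_self m) _ _ (herase T hT) (herase S hS))
    · rw [← Finset.add_sum_erase T _ hmT, ← Finset.erase_eq_of_notMem hmS] at hST
      exact absurd hST (hne m (Nat.lt_succ_self m) _ _ (herase S hS) (herase T hT))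
    · rw [← Finset.erase_eq_of_notMem hmS, ← Finset.erase_eq_of_notMem hmT] at hST ⊢
      exact hrest (herase S hS) (herase T hT) hST

lemma injOn_codePerm {d : ℝ} (hd0 : d ≠ 0) (hd : |d| ≤ 2) {m κ : ℕ} (h : 32 * m ≤ κ + 2) :
    Set.InjOn (codePerm d m (κ + 2) κ) {S | S ⊆ range m} := by
  have hF : ∀ i, (0 : ℝ) < ((2 * i + (κ + 2)).factorial : ℝ) := fun i => by
    exact_mod_cast Nat.factorial_pos _
  have hbounds : ∀ i < m, 1 / 2 * ((2 * i + (κ + 2)).factorial : ℝ) ≤ |bitMinor d (κ + 2) κ i| ∧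
      |bitMinor d (κ + 2) κ i| ≤ 3 / 2 * ((2 * i + (κ + 2)).factorial : ℝ) := by
    intro i hi
    have h1 := abs_le.1 (abs_bitMinor_sub_factorial_le hd (κ := κ) (i := i) (by omega))
    have := hF i
    rw [abs_of_pos (by linarith)]
    constructor <;> linarith
  have hinj := injOn_subset_sum (m := m)
    (E := fun i => d ^ (2 * (m - i)) * bitMinor d (κ + 2) κ i) ?_ ?_
  · intro S hS T hT hST
    rw [codePerm_eq_sum d m _ κ hS, codePerm_eq_sum d m _ κ hT] at hST
    exact hinj hS hT (sub_right_injective hST)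
  · intro i hi
    refine mul_ne_zero (pow_ne_zero _ hd0) (abs_pos.1 ?_)
    linarith [(hbounds i hi).1, hF i]
  · intro i hi
    have hpow : d ^ (2 * (m - i)) = d ^ (2 * (m - (i + 1))) * d ^ 2 := by
      rw [← pow_add]
      congr 1
      omega
    have hd2 : |d ^ 2| ≤ 4 := by
      rw [abs_pow]
      nlinarith [abs_nonneg d]
    have hfac : (4 * 6 : ℝ) * ((2 * i + (κ + 2)).factorial : ℝ) ≤
        ((2 * (i + 1) + (κ + 2)).factorial : ℝ) := by
      rw [show 2 * (i + 1) + (κ + 2) = 2 * i + (κ + 2) + 1 + 1 by ring, Nat.factorial_succ,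
        Nat.factorial_succ, ← mul_assoc]
      have : 4 * 6 ≤ (2 * i + (κ + 2) + 1 + 1) * (2 * i + (κ + 2) + 1) :=
        Nat.mul_le_mul (by omega) (by omega)
      exact_mod_cast Nat.mul_le_mul_right _ this
    have h1 := (hbounds i (by omega)).2
    have h2 := (hbounds (i + 1) hi).1
    rw [hpow, abs_mul, abs_mul, abs_mul]
    have h3 : |d ^ 2| * |bitMinor d (κ + 2) κ i| ≤
        4 * (3 / 2 * ((2 * i + (κ + 2)).factorial : ℝ)) :=
      mul_le_mul hd2 h1 (abs_nonneg _) (by norm_num)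
    have h4 : 2 * (|d ^ 2| * |bitMinor d (κ + 2) κ i|) ≤ |bitMinor d (κ + 2) κ (i + 1)| := by
      linarith
    calc 2 * (|d ^ (2 * (m - (i + 1)))| * |d ^ 2| * |bitMinor d (κ + 2) κ i|)
        = |d ^ (2 * (m - (i + 1)))| * (2 * (|d ^ 2| * |bitMinor d (κ + 2) κ i|)) := by ring
      _ ≤ _ := mul_le_mul_of_nonneg_left h4 (abs_nonneg _)

/-- The permanents of `n × n` matrices with entries in `{a, b}`. -/
def permValues (a b : ℝ) (n : ℕ) : Set ℝ :=
  {z : ℝ | ∃ A : Matrix (Fin n) (Fin n) ℝ, (∀ i j, A i j = a ∨ A i j = b) ∧ perm A = z}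

lemma permValues_comm (a b : ℝ) (n : ℕ) : permValues a b n = permValues b a n := by
  ext z
  simp only [permValues, Set.mem_ofPred_eq, or_comm]

lemma finite_permValues (a b : ℝ) (n : ℕ) : (permValues a b n).Finite := by
  refine (Set.finite_range fun B : Fin n → Fin n → Bool =>
    perm (Matrix.of fun i j => if B i j then a else b)).subset ?_
  rintro z ⟨A, hA, rfl⟩
  refine ⟨fun i j => decide (A i j = a), congrArg perm ?_⟩
  ext i j
  by_cases h : A i j = a
  · simp [h]
  · simpa [h] using ((hA i j).resolve_left h).symm

lemma perm_smul {n : ℕ} (a : ℝ) (M : Matrix (Fin n) (Fin n) ℝ) :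
    perm (a • M) = a ^ n * perm M := by
  simp [perm, Finset.prod_mul_distrib, Finset.mul_sum]

lemma two_le_ncard_permValues {a b : ℝ} (ha : a ≠ 0) (hab : a ≠ b) {n : ℕ} (hn : 1 ≤ n) :
    2 ≤ (permValues a b n).ncard := by
  obtain ⟨k, rfl⟩ : ∃ k, n = k + 1 := ⟨n - 1, by omega⟩
  have hval : ∀ x, x = a ∨ x = b →
      ((k + 1).factorial : ℝ) * (x * a ^ k) ∈ permValues a b (k + 1) := by
    intro x hx
    refine ⟨Matrix.of fun i _ => if i = 0 then x else a, fun i j => ?_, ?_⟩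
    · by_cases h : i = 0
      · simpa [h] using hx
      · simp [h]
    · simp [perm, Fin.prod_univ_succ, Fintype.card_perm]
  have hsub : ({((k + 1).factorial : ℝ) * (a * a ^ k), ((k + 1).factorial : ℝ) * (b * a ^ k)} :
      Set ℝ) ⊆ permValues a b (k + 1) :=
    Set.insert_subset (hval a (Or.inl rfl)) (Set.singleton_subset_iff.2 (hval b (Or.inr rfl)))
  rw [← Set.ncard_pair (a := ((k + 1).factorial : ℝ) * (a * a ^ k))
    (b := ((k + 1).factorial : ℝ) * (b * a ^ k))]
  · exact Set.ncard_le_ncard hsub (finite_permValues a b _)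
  · intro h
    have hfac : ((k + 1).factorial : ℝ) ≠ 0 := by exact_mod_cast Nat.factorial_ne_zero _
    exact hab (mul_right_cancel₀ (pow_ne_zero k ha) (mul_left_cancel₀ hfac h))

lemma mul_codePerm_mem_permValues {a b d : ℝ} (hb : b = a * (1 + d)) (m κ : ℕ) (S : Finset ℕ) :
    a ^ (2 * m + (κ + 2)) * codePerm d m (κ + 2) κ S ∈ permValues a b (2 * m + (κ + 2)) := by
  set l := twinRows m 0 ++ List.replicate (κ + 2) none with hl
  set C := insert (Col.code S) (laneCols 0 m ∪ baseCols κ 0) with hC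
  have hlen : l.length = 2 * m + (κ + 2) := by
    rw [hl, List.length_append, length_twinRows, List.length_replicate]
  have hcard : C.card = 2 * m + (κ + 2) := by
    have h1 : laneCols 0 m = insert (Col.lane true m)
        ((range m).image (Col.lane true) ∪ (range m).image (Col.lane false)) := by
      ext c
      rcases c with ⟨b, k⟩ | S | k
      · cases b <;> simp [lane_mem_laneCols] <;> omega
      · simp [code_notMem_laneCols]
      · simp [pad_notMem_laneCols]
    have h2 : laneCols 0 m ∪ baseCols κ 0 = insert (Col.lane true m) (baseCols κ m) := by
      rw [h1, Finset.insert_union]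
      simp [baseCols]
    rw [hC, h2, Finset.card_insert_of_notMem, Finset.card_insert_of_notMem, card_baseCols]
    · ring
    · simp [lane_mem_baseCols]
    · simp [code_notMem_baseCols]
  set f : Fin (2 * m + (κ + 2)) → Col := fun i => (C.equivFinOfCardEq hcard).symm i with hf
  have hfinj : Function.Injective f :=
    Subtype.val_injective.comp (C.equivFinOfCardEq hcard).symm.injective
  have himg : univ.image f = C := by
    ext c
    simp only [hf, mem_image, mem_univ, true_and]
    constructor
    · rintro ⟨i, rfl⟩
      exact ((C.equivFinOfCardEq hcard).symm i).2
    · intro hc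
      exact ⟨C.equivFinOfCardEq hcard ⟨c, hc⟩, by simp⟩
  refine ⟨a • Matrix.of fun i j => entry d (l.get (i.cast hlen.symm)) (f j), fun i j => ?_, ?_⟩
  · rw [Matrix.smul_apply, Matrix.of_apply, smul_eq_mul, hb]
    rcases entry_eq_one_or d (l.get (i.cast hlen.symm)) (f j) with h | h <;> rw [h] <;> simp
  · rw [perm_smul, perm_eq_listPerm _ _ hlen hfinj, himg, codePerm]

lemma two_pow_le_ncard_permValues {a b : ℝ} (ha : a ≠ 0) (hab : a ≠ b) (hba : |b| ≤ |a|) {m κ : ℕ}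
    (h : 32 * m ≤ κ + 2) : 2 ^ m ≤ (permValues a b (2 * m + (κ + 2))).ncard := by
  set d := b / a - 1 with hd
  have hb : b = a * (1 + d) := by
    rw [hd]
    field_simp
    ring
  have hd0 : d ≠ 0 := by
    intro h0
    rw [h0] at hb
    exact hab (by rw [hb]; ring)
  have hd2 : |d| ≤ 2 := by
    have : |b / a| ≤ 1 := by
      rw [abs_div]
      exact div_le_one_of_le₀ hba (abs_nonneg a)
    have := abs_le.1 this
    rw [hd, abs_le]
    constructor <;> linarith
  have hinj : Set.InjOn (fun S => a ^ (2 * m + (κ + 2)) * codePerm d m (κ + 2) κ S)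
      ((range m).powerset : Set (Finset ℕ)) := by
    intro S hS T hT hST
    exact injOn_codePerm hd0 hd2 h (Finset.mem_powerset.1 hS) (Finset.mem_powerset.1 hT)
      (mul_left_cancel₀ (pow_ne_zero _ ha) hST)
  have hcard := Finset.card_image_of_injOn hinj
  rw [Finset.card_powerset, Finset.card_range] at hcard
  rw [← hcard, ← Set.ncard_coe_finset]
  refine Set.ncard_le_ncard ?_ (finite_permValues a b _)
  intro z hz
  obtain ⟨S, -, rfl⟩ := Finset.mem_image.1 (Finset.mem_coe.1 hz)
  exact mul_codePerm_mem_permValues hb m κ S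

lemma exp_le_ncard_permValues {a b : ℝ} (hab : a ≠ b) (hba : |b| ≤ |a|) {n : ℕ} (hn : 1 ≤ n) :
    Real.exp (Real.log 2 / 80 * n) ≤ ((permValues a b n).ncard : ℝ) := by
  have ha : a ≠ 0 := by
    rintro rfl
    rw [abs_zero] at hba
    exact hab (abs_nonpos_iff.1 hba).symm
  have hlog : 0 < Real.log 2 := Real.log_pos (by norm_num)
  have hexp : ∀ k : ℕ, n ≤ 80 * k → Real.exp (Real.log 2 / 80 * n) ≤ ((2 ^ k : ℕ) : ℝ) := by
    intro k hk
    have hk' : (n : ℝ) ≤ 80 * k := by exact_mod_cast hk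
    have : ((2 ^ k : ℕ) : ℝ) = Real.exp (Real.log 2 * k) := by
      rw [Real.exp_mul, Real.exp_log (by norm_num), Real.rpow_natCast]
      push_cast
      rfl
    rw [this, Real.exp_le_exp]
    nlinarith
  rcases lt_or_ge n 40 with hlt | hge
  · refine (hexp 1 (by omega)).trans ?_
    exact_mod_cast two_le_ncard_permValues ha hab hn
  · obtain ⟨κ, hκ⟩ : ∃ κ, n = 2 * (n / 40) + (κ + 2) := ⟨n - 2 * (n / 40) - 2, by omega⟩
    refine (hexp (n / 40) (by omega)).trans ?_
    have := two_pow_le_ncard_permValues ha hab hba (m := n / 40) (κ := κ) (by omega)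
    rw [← hκ] at this
    exact_mod_cast this

end Counting

theorem stmt16 :
    ∃ c : ℝ, 0 < c ∧
      ∀ (a b : ℝ), a ≠ b → ∀ n : ℕ, 1 ≤ n →
        Real.exp (c * n) ≤
          (({z : ℝ | ∃ A : Matrix (Fin n) (Fin n) ℝ,
              (∀ i j, A i j = a ∨ A i j = b) ∧ perm A = z}).ncard : ℝ) := by
  refine ⟨Real.log 2 / 80, div_pos (Real.log_pos (by norm_num)) (by norm_num), ?_⟩
  intro a b hab n hn
  change _ ≤ ((permValues a b n).ncard : ℝ)
  rcases le_total |b| |a| with h | h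
  · exact exp_le_ncard_permValues hab h hn
  · rw [permValues_comm]
    exact exp_le_ncard_permValues hab.symm h hn
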